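/- (Characterization of equality of basic conditionals.) For all events A, C ⊆ Ω and all nonempty events B, D ⊆ Ω: ⟦A∣B⟧ = ⟦C∣D⟧ if and only if either both ⟦A∣B⟧ and ⟦C∣D⟧ equal the set of all enumerations, or both are empty, or (A∩B = C∩D and B = D). -/

import Mathlib

open Finset

variable {Ω : Type*}

noncomputable def sigmaFirst [Fintype Ω] [DecidableEq Ω] [Nonempty Ω]
    (σ : Fin (Fintype.card Ω) ≃ Ω) (B : Finset Ω) : Ω :=
  if h : (Finset.univ.filter fun i => σ i ∈ B).Nonempty then
    σ ((Finset.univ.filter fun i => σ i ∈ B).min' h)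
  else Classical.arbitrary Ω

def condEvent [Fintype Ω] [DecidableEq Ω] [Nonempty Ω]
    (A B : Finset Ω) : Set (Fin (Fintype.card Ω) ≃ Ω) :=
  {σ | sigmaFirst σ B ∈ A}

theorem sigmaFirst_mem [Fintype Ω] [DecidableEq Ω] [Nonempty Ω]
    (σ : Fin (Fintype.card Ω) ≃ Ω) {B : Finset Ω} (hB : B.Nonempty) :
    sigmaFirst σ B ∈ B := by
  obtain ⟨b, hb⟩ := hB
  have h : (Finset.univ.filter fun i => σ i ∈ B).Nonempty := ⟨σ.symm b, by simpa using hb⟩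
  rw [sigmaFirst, dif_pos h]
  exact (Finset.mem_filter.mp (Finset.min'_mem _ h)).2

theorem sigmaFirst_eq_of_forall_lt [Fintype Ω] [DecidableEq Ω] [Nonempty Ω]
    (σ : Fin (Fintype.card Ω) ≃ Ω) {B : Finset Ω} {i : Fin (Fintype.card Ω)}
    (hi : σ i ∈ B) (hlt : ∀ j < i, σ j ∉ B) : sigmaFirst σ B = σ i := by
  have h : (Finset.univ.filter fun i => σ i ∈ B).Nonempty := ⟨i, by simpa using hi⟩
  rw [sigmaFirst, dif_pos h]
  congr 1
  refine le_antisymm (Finset.min'_le _ _ (by simpa using hi)) (Finset.le_min' _ _ _ ?_)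
  intro j hj
  by_contra hji
  exact hlt j (not_le.mp hji) (Finset.mem_filter.mp hj).2

theorem exists_enumeration_sigmaFirst_eq [Fintype Ω] [DecidableEq Ω] [Nonempty Ω] (x : Ω) :
    ∃ σ : Fin (Fintype.card Ω) ≃ Ω, ∀ B : Finset Ω, x ∈ B → sigmaFirst σ B = x := by
  let e := (Fintype.equivFin Ω).symm
  let z : Fin (Fintype.card Ω) := ⟨0, Fintype.card_pos⟩
  have hz : (e.trans (Equiv.swap (e z) x)) z = x := by simp
  refine ⟨e.trans (Equiv.swap (e z) x), fun B hx => ?_⟩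
  rw [sigmaFirst_eq_of_forall_lt _ (i := z) (by rwa [hz]), hz]
  intro j hj
  exact absurd (Fin.lt_def.mp hj) (Nat.not_lt_zero _)

theorem exists_enumeration_sigmaFirst_eq_pair [Fintype Ω] [DecidableEq Ω] [Nonempty Ω]
    {x y : Ω} (hxy : x ≠ y) :
    ∃ σ : Fin (Fintype.card Ω) ≃ Ω, (∀ B : Finset Ω, x ∈ B → sigmaFirst σ B = x) ∧
      ∀ B : Finset Ω, x ∉ B → y ∈ B → sigmaFirst σ B = y := by
  let e := (Fintype.equivFin Ω).symm
  let z : Fin (Fintype.card Ω) := ⟨0, Fintype.card_pos⟩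
  let o : Fin (Fintype.card Ω) := ⟨1, Fintype.one_lt_card_iff.mpr ⟨x, y, hxy⟩⟩
  have hzo : z ≠ o := by simp [z, o]
  let f := e.trans (Equiv.swap (e z) x)
  have hf : f z = x := by simp [f]
  have hfo : x ≠ f o := fun h => hzo (f.injective (hf.trans h))
  let σ := f.trans (Equiv.swap (f o) y)
  have hσz : σ z = x := by
    simp only [σ, Equiv.trans_apply, hf]
    exact Equiv.swap_apply_of_ne_of_ne hfo hxy
  have hσo : σ o = y := by simp [σ]
  refine ⟨σ, fun B hx => ?_, fun B hx hy => ?_⟩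
  · rw [sigmaFirst_eq_of_forall_lt _ (i := z) (by rwa [hσz]), hσz]
    intro j hj
    exact absurd (Fin.lt_def.mp hj) (Nat.not_lt_zero _)
  · rw [sigmaFirst_eq_of_forall_lt _ (i := o) (by rwa [hσo]), hσo]
    intro j hj
    have hj0 : j = z := Fin.ext (Nat.lt_one_iff.mp (Fin.lt_def.mp hj))
    rwa [hj0, hσz]

theorem exists_mem_of_condEvent_ne_empty [Fintype Ω] [DecidableEq Ω] [Nonempty Ω]
    {A B : Finset Ω} (hB : B.Nonempty) (h : condEvent A B ≠ ∅) : ∃ b ∈ B, b ∈ A := by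
  obtain ⟨σ, hσ⟩ := Set.nonempty_iff_ne_empty.mpr h
  exact ⟨_, sigmaFirst_mem σ hB, hσ⟩

theorem exists_notMem_of_condEvent_ne_univ [Fintype Ω] [DecidableEq Ω] [Nonempty Ω]
    {A B : Finset Ω} (hB : B.Nonempty) (h : condEvent A B ≠ Set.univ) : ∃ b ∈ B, b ∉ A := by
  obtain ⟨σ, hσ⟩ := (Set.ne_univ_iff_exists_notMem _).mp h
  exact ⟨_, sigmaFirst_mem σ hB, hσ⟩

theorem subset_of_condEvent_eq [Fintype Ω] [DecidableEq Ω] [Nonempty Ω]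
    {A B C D : Finset Ω} (hD : D.Nonempty) (h : condEvent A B = condEvent C D)
    (hne : condEvent C D ≠ ∅) (hnu : condEvent C D ≠ Set.univ) : B ⊆ D := by
  intro x hxB
  by_contra hxD
  have key : ∀ y ∈ D, x ∈ A ↔ y ∈ C := by
    intro y hy
    obtain ⟨σ, hx, hσy⟩ :=
      exists_enumeration_sigmaFirst_eq_pair (x := x) (y := y) (fun e => hxD (e ▸ hy))
    have hσ : sigmaFirst σ B ∈ A ↔ sigmaFirst σ D ∈ C := Set.ext_iff.mp h σ
    rwa [hx B hxB, hσy D hxD hy] at hσ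
  obtain ⟨c, hcD, hcC⟩ := exists_mem_of_condEvent_ne_empty hD hne
  obtain ⟨d, hdD, hdC⟩ := exists_notMem_of_condEvent_ne_univ hD hnu
  exact hdC ((key d hdD).mp ((key c hcD).mpr hcC))

theorem stmt9 [Fintype Ω] [DecidableEq Ω] [Nonempty Ω]
    (A C B D : Finset Ω) (hB : B.Nonempty) (hD : D.Nonempty) :
    condEvent A B = condEvent C D ↔
      (condEvent A B = (Set.univ : Set (Fin (Fintype.card Ω) ≃ Ω)) ∧
        condEvent C D = Set.univ) ∨
      (condEvent A B = ∅ ∧ condEvent C D = ∅) ∨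
      (A ∩ B = C ∩ D ∧ B = D) := by
  constructor
  · intro h
    by_cases hu : condEvent C D = Set.univ
    · exact Or.inl ⟨h.trans hu, hu⟩
    by_cases he : condEvent C D = ∅
    · exact Or.inr (Or.inl ⟨h.trans he, he⟩)
    have hBD : B = D := (subset_of_condEvent_eq hD h he hu).antisymm
      (subset_of_condEvent_eq hB h.symm (h ▸ he) (h ▸ hu))
    subst hBD
    refine Or.inr (Or.inr ⟨?_, rfl⟩)
    ext x
    simp only [Finset.mem_inter, and_congr_left_iff]
    intro hx
    obtain ⟨σ, hσx⟩ := exists_enumeration_sigmaFirst_eq x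
    have hσ : sigmaFirst σ B ∈ A ↔ sigmaFirst σ B ∈ C := Set.ext_iff.mp h σ
    rwa [hσx B hx] at hσ
  · rintro (⟨h₁, h₂⟩ | ⟨h₁, h₂⟩ | ⟨hAC, rfl⟩)
    · exact h₁.trans h₂.symm
    · exact h₁.trans h₂.symm
    · ext σ
      have hσ := Finset.ext_iff.mp hAC (sigmaFirst σ B)
      simpa [condEvent, sigmaFirst_mem σ hB] using hσ
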